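/- arXiv:2605.14643 — 2 statements merged into one kernel-verified Lean document; each statement's English description precedes it below -/
import Mathlib

section
/- Let H be a symmetric d×d real matrix and ξ a standard Gaussian vector in ℝ^d. Then E[(ξᵀHξ - Tr(H))⁴] = 48 Tr(H⁴) + 12 (Tr(H²))². -/
open MeasureTheory ProbabilityTheory Matrix

/-- Standard Gaussian measure N(0, I_d) on ℝ^d. -/
noncomputable def stdGaussian (d : ℕ) : Measure (Fin d → ℝ) :=
  Measure.pi fun _ => gaussianReal 0 1

lemma gauss_even_moment (n : ℕ) :
    ∫ x : ℝ, x ^ (2 * n) ∂(gaussianReal 0 1) = ((2 * n - 1 : ℕ).doubleFactorial : ℝ) := by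
  rw [integral_gaussianReal_eq_integral_smul (by norm_num)]
  have h1 : ∀ x : ℝ, gaussianPDFReal 0 1 x • x ^ (2 * n)
      = (fun y : ℝ => (√(2 * Real.pi))⁻¹ * (y ^ ((2 * n : ℕ) : ℝ) * Real.exp (-(1 / 2) * y ^ (2 : ℝ)))) |x| := by
    intro x
    simp only [gaussianPDFReal, Real.rpow_natCast, smul_eq_mul, Real.rpow_two, sq_abs]
    rw [pow_mul |x|, sq_abs, ← pow_mul]
    have : -(x - 0) ^ 2 / (2 * ((1 : NNReal) : ℝ)) = -(1 / 2) * x ^ 2 := by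
      simp; ring
    rw [this]
    simp
    ring
  simp_rw [h1]
  rw [integral_comp_abs (f := fun y : ℝ => (√(2 * Real.pi))⁻¹ * (y ^ ((2 * n : ℕ) : ℝ) * Real.exp (-(1 / 2) * y ^ (2 : ℝ))))]
  rw [integral_const_mul, integral_rpow_mul_exp_neg_mul_rpow (by norm_num)
    (lt_of_lt_of_le (by norm_num) (Nat.cast_nonneg _)) (by norm_num)]
  have h2 : (((2 * n : ℕ) : ℝ) + 1) / 2 = n + 1 / 2 := by push_cast; ring
  have h3 : -(((2 * n : ℕ) : ℝ) + 1) / 2 = -(n + 1 / 2) := by push_cast; ring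
  rw [h2, h3, Real.Gamma_nat_add_half, Real.rpow_neg (by norm_num), Real.rpow_add (by norm_num),
    Real.rpow_natCast, ← Real.sqrt_eq_rpow, Real.sqrt_mul (by norm_num)]
  have hp : √Real.pi ≠ 0 := by positivity
  have h4 : √(2:ℝ) ≠ 0 := by positivity
  rw [Real.sqrt_div (by norm_num), Real.sqrt_one]
  field_simp
  rw [← mul_pow]; norm_num

lemma gauss_int_pow (n : ℕ) : Integrable (fun x : ℝ => x ^ n) (gaussianReal 0 1) := by
  have := (memLp_id_gaussianReal (μ := 0) (v := 1) (n : NNReal)).integrable_norm_pow' 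
  refine (integrable_norm_iff (by fun_prop)).1 ?_
  simpa using this

lemma z_mom (n : ℕ) : Integrable (fun x : ℝ => (x ^ 2 - 1) ^ n) (gaussianReal 0 1) := by
  simp_rw [sub_eq_add_neg, add_pow]
  refine integrable_finsetSum _ fun i _ => ?_
  simp_rw [← pow_mul]
  exact ((gauss_int_pow _).mul_const _).mul_const _

lemma z1 : ∫ x : ℝ, (x ^ 2 - 1) ∂(gaussianReal 0 1) = 0 := by
  have m1 := gauss_even_moment 1
  have e : (fun x : ℝ => x ^ 2 - 1) = fun x => x ^ 2 + (-1) * x ^ 0 := by ext; ring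
  rw [e, integral_add (gauss_int_pow 2) ((gauss_int_pow 0).const_mul _), integral_const_mul]
  norm_num [Nat.doubleFactorial] at m1 ⊢; linarith

lemma z2 : ∫ x : ℝ, (x ^ 2 - 1) ^ 2 ∂(gaussianReal 0 1) = 2 := by
  have m1 := gauss_even_moment 1
  have m2 := gauss_even_moment 2
  have e : (fun x : ℝ => (x ^ 2 - 1) ^ 2) = fun x => x ^ 4 + ((-2) * x ^ 2 + 1 * x ^ 0) := by ext; ring
  have I := fun n c => (gauss_int_pow n).const_mul c
  rw [e, integral_add (gauss_int_pow 4) ((I _ _).fun_add (I _ _)), integral_add (I _ _) (I _ _),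
    integral_const_mul, integral_const_mul]
  norm_num [Nat.doubleFactorial] at m1 m2 ⊢; linarith

lemma z3 : ∫ x : ℝ, (x ^ 2 - 1) ^ 3 ∂(gaussianReal 0 1) = 8 := by
  have m1 := gauss_even_moment 1
  have m2 := gauss_even_moment 2
  have m3 := gauss_even_moment 3
  have e : (fun x : ℝ => (x ^ 2 - 1) ^ 3) =
    fun x => x ^ 6 + ((-3) * x ^ 4 + (3 * x ^ 2 + (-1) * x ^ 0)) := by ext; ring
  have I := fun n c => (gauss_int_pow n).const_mul c
  rw [e, integral_add (gauss_int_pow _) ((I _ _).fun_add ((I _ _).fun_add (I _ _))),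
    integral_add (I _ _) ((I _ _).fun_add (I _ _)), integral_add (I _ _) (I _ _),
    integral_const_mul, integral_const_mul, integral_const_mul]
  norm_num [Nat.doubleFactorial] at m1 m2 m3 ⊢; linarith

lemma z4 : ∫ x : ℝ, (x ^ 2 - 1) ^ 4 ∂(gaussianReal 0 1) = 60 := by
  have m1 := gauss_even_moment 1
  have m2 := gauss_even_moment 2
  have m3 := gauss_even_moment 3
  have m4 := gauss_even_moment 4
  have e : (fun x : ℝ => (x ^ 2 - 1) ^ 4) =
    fun x => x ^ 8 + ((-4) * x ^ 6 + (6 * x ^ 4 + ((-4) * x ^ 2 + 1 * x ^ 0))) := by ext; ring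
  have I := fun n c => (gauss_int_pow n).const_mul c
  rw [e, integral_add (gauss_int_pow _) ((I _ _).fun_add ((I _ _).fun_add ((I _ _).fun_add (I _ _)))),
    integral_add (I _ _) ((I _ _).fun_add ((I _ _).fun_add (I _ _))),
    integral_add (I _ _) ((I _ _).fun_add (I _ _)), integral_add (I _ _) (I _ _),
    integral_const_mul, integral_const_mul, integral_const_mul, integral_const_mul]
  norm_num [Nat.doubleFactorial] at m1 m2 m3 m4 ⊢; linarith

/-- one-step moments for independent sums -/
lemma step {Ω : Type*} [MeasurableSpace Ω] {P : Measure Ω} [IsProbabilityMeasure P] {S Z : Ω → ℝ}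
    (hind : IndepFun S Z P)
    (iS : ∀ n : ℕ, Integrable (fun w => S w ^ n) P) (iZ : ∀ n : ℕ, Integrable (fun w => Z w ^ n) P)
    (k l : ℕ) : Integrable (fun w => S w ^ k * Z w ^ l) P ∧
      ∫ w, S w ^ k * Z w ^ l ∂P = (∫ w, S w ^ k ∂P) * ∫ w, Z w ^ l ∂P := by
  have h : IndepFun (fun w => S w ^ k) (fun w => Z w ^ l) P :=
    hind.comp (φ := fun x => x ^ k) (ψ := fun x => x ^ l) (by fun_prop) (by fun_prop)
  exact ⟨h.integrable_mul (iS k) (iZ l),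
    h.integral_fun_mul_eq_mul_integral (iS k).aestronglyMeasurable (iZ l).aestronglyMeasurable⟩

lemma sum_moments {d : ℕ} (c : Fin d → ℝ) (s : Finset (Fin d)) :
    let P : Measure (Fin d → ℝ) := Measure.pi fun _ => gaussianReal 0 1
    let S : (Fin d → ℝ) → ℝ := fun x => ∑ i ∈ s, c i * (x i ^ 2 - 1)
    (∀ n : ℕ, Integrable (fun x => S x ^ n) P) ∧ ∫ x, S x ∂P = 0 ∧
      ∫ x, S x ^ 2 ∂P = 2 * ∑ i ∈ s, c i ^ 2 ∧
      ∫ x, S x ^ 4 ∂P = 48 * ∑ i ∈ s, c i ^ 4 + 12 * (∑ i ∈ s, c i ^ 2) ^ 2 := by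
  classical
  intro P
  induction s using Finset.induction_on with
  | empty => simp
  | insert j s hj ih =>
    intro S
    obtain ⟨i0, i1, i2, i4⟩ := ih
    set T : (Fin d → ℝ) → ℝ := fun x => ∑ i ∈ s, c i * (x i ^ 2 - 1) with hT
    set Z : (Fin d → ℝ) → ℝ := fun x => x j ^ 2 - 1 with hZ
    have hS : ∀ x, S x = T x + c j * Z x := fun x => by
      simp only [S, T, Z, Finset.sum_insert hj]; ring
    have hTm : Measurable T := by fun_prop
    have hZm : Measurable Z := by fun_prop
    have mp : MeasurePreserving (Function.eval j) P (gaussianReal 0 1) :=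
      measurePreserving_eval (fun _ : Fin d => gaussianReal 0 1) j
    have hZi : ∀ n : ℕ, Integrable (fun w => Z w ^ n) P := fun n =>
      mp.integrable_comp_of_integrable (z_mom n)
    have hZv : ∀ n : ℕ, ∫ w, Z w ^ n ∂P = ∫ x : ℝ, (x ^ 2 - 1) ^ n ∂(gaussianReal 0 1) := by
      intro n
      rw [← mp.map_eq, integral_map mp.aemeasurable (by fun_prop)]
    have hind : IndepFun T Z P := by
      have h0 : iIndepFun (fun i (x : Fin d → ℝ) => x i) P :=
        iIndepFun_pi (μ := fun _ : Fin d => gaussianReal 0 1)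
          (X := fun i (x : ℝ) => x) (fun i => by fun_prop)
      have h2 := h0.indepFun_finset s {j} (by simpa using hj) (fun i => by fun_prop)
      exact h2.comp (φ := fun y => ∑ i : s, c i * (y i ^ 2 - 1))
        (ψ := fun y : (({j} : Finset (Fin d)) → ℝ) => y ⟨j, Finset.mem_singleton_self j⟩ ^ 2 - 1) (by fun_prop) (by fun_prop) |>.congr
          (by
            refine Filter.Eventually.of_forall fun x => ?_
            simp only [hT, Function.comp]
            exact Finset.sum_coe_sort s (fun i => c i * (x i ^ 2 - 1)))
          (Filter.Eventually.of_forall fun x => rfl)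
    have key := step hind i0 hZi
    have v1 : ∫ w, Z w ^ 1 ∂P = 0 := by rw [hZv]; simpa using z1
    have v2 := (hZv 2).trans z2
    have v3 := (hZv 3).trans z3
    have v4 := (hZv 4).trans z4
    have I : ∀ k l (a : ℝ), Integrable (fun w => a * (T w ^ k * Z w ^ l)) P :=
      fun k l a => (key k l).1.const_mul a
    have v0 : ∫ w, Z w ^ 0 ∂P = 1 := by simp
    have t0 : ∫ w, T w ^ 0 ∂P = 1 := by simp
    have t1 : ∫ w, T w ^ 1 ∂P = 0 := by simpa using i1
    refine ⟨?_, ?_, ?_, ?_⟩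
    · intro n
      simp_rw [hS, add_pow, mul_pow]
      refine integrable_finsetSum _ fun i _ => ?_
      refine (I i (n - i) (c j ^ (n - i) * (n.choose i))).congr ?_
      exact Filter.Eventually.of_forall fun x => by ring
    · have e : S = fun x => 1 * (T x ^ 1 * Z x ^ 0) + c j * (T x ^ 0 * Z x ^ 1) := by
        ext x; rw [hS]; ring
      rw [e, integral_add (I _ _ _) (I _ _ _), integral_const_mul, integral_const_mul,
        (key _ _).2, (key _ _).2, v1, t1]
      ring
    · have e : (fun x => S x ^ 2) = fun x => 1 * (T x ^ 2 * Z x ^ 0) +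
          ((2 * c j) * (T x ^ 1 * Z x ^ 1) + (c j ^ 2) * (T x ^ 0 * Z x ^ 2)) := by
        ext x; rw [hS]; ring
      rw [e, integral_add (I _ _ _) ((I _ _ _).fun_add (I _ _ _)), integral_add (I _ _ _) (I _ _ _),
        integral_const_mul, integral_const_mul, integral_const_mul,
        (key _ _).2, (key _ _).2, (key _ _).2, v1, t1, v0, t0, v2, i2, Finset.sum_insert hj]
      ring
    · have e : (fun x => S x ^ 4) = fun x => 1 * (T x ^ 4 * Z x ^ 0) +
          ((4 * c j) * (T x ^ 3 * Z x ^ 1) + ((6 * c j ^ 2) * (T x ^ 2 * Z x ^ 2) +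
          ((4 * c j ^ 3) * (T x ^ 1 * Z x ^ 3) + (c j ^ 4) * (T x ^ 0 * Z x ^ 4)))) := by
        ext x; rw [hS]; ring
      rw [e, integral_add (I _ _ _) ((I _ _ _).fun_add ((I _ _ _).fun_add ((I _ _ _).fun_add (I _ _ _)))),
        integral_add (I _ _ _) ((I _ _ _).fun_add ((I _ _ _).fun_add (I _ _ _))),
        integral_add (I _ _ _) ((I _ _ _).fun_add (I _ _ _)), integral_add (I _ _ _) (I _ _ _),
        integral_const_mul, integral_const_mul, integral_const_mul, integral_const_mul,
        integral_const_mul,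
        (key _ _).2, (key _ _).2, (key _ _).2, (key _ _).2, (key _ _).2,
        v1, t1, v0, t0, v2, v3, v4, i2, i4, Finset.sum_insert hj, Finset.sum_insert hj]
      ring

lemma trace_pow_eig {d : ℕ} {H : Matrix (Fin d) (Fin d) ℝ} (hA : H.IsHermitian) (k : ℕ) :
    (H ^ k).trace = ∑ i, hA.eigenvalues i ^ k := by
  conv_lhs => rw [hA.spectral_theorem, ← map_pow, Unitary.conjStarAlgAut_apply, trace_mul_cycle]
  simp [diagonal_pow, trace_diagonal]

lemma quad_eig {d : ℕ} {H : Matrix (Fin d) (Fin d) ℝ} (hA : H.IsHermitian) (y : Fin d → ℝ) :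
    (WithLp.ofLp (∑ i, y i • hA.eigenvectorBasis i)) ⬝ᵥ
      H.mulVec (WithLp.ofLp (∑ i, y i • hA.eigenvectorBasis i)) =
      ∑ i, hA.eigenvalues i * y i ^ 2 := by
  have h : H.mulVec (WithLp.ofLp (∑ i, y i • hA.eigenvectorBasis i)) =
      WithLp.ofLp (∑ i, (hA.eigenvalues i * y i) • hA.eigenvectorBasis i) := by
    simp only [WithLp.ofLp_sum, WithLp.ofLp_smul, mulVec_sum, mulVec_smul,
      hA.mulVec_eigenvectorBasis]
    refine Finset.sum_congr rfl fun i _ => ?_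
    rw [smul_smul, mul_comm]
  rw [h]
  have h2 : ∀ u v : EuclideanSpace ℝ (Fin d), u.ofLp ⬝ᵥ v.ofLp = inner ℝ u v := by
    intro u v
    simp [PiLp.inner_apply, dotProduct, mul_comm]
  rw [h2, hA.eigenvectorBasis.orthonormal.inner_sum]
  refine Finset.sum_congr rfl fun i _ => ?_
  simp; ring

theorem gaussian_quadratic_centered_fourth_moment
    (d : ℕ) (H : Matrix (Fin d) (Fin d) ℝ) (hH : H.IsSymm) :
    ∫ x : Fin d → ℝ, (x ⬝ᵥ H.mulVec x - H.trace) ^ 4 ∂(stdGaussian d)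
      = 48 * (H ^ 4).trace + 12 * (H ^ 2).trace ^ 2 := by
  have hA : H.IsHermitian := by
    rw [Matrix.IsHermitian, conjTranspose_eq_transpose_of_trivial]; exact hH
  have hm : Continuous (fun x : Fin d → ℝ => (x ⬝ᵥ H.mulVec x - H.trace) ^ 4) := by
    unfold dotProduct mulVec dotProduct
    fun_prop
  have h1 := map_pi_eq_stdGaussian (ι := Fin d)
  rw [stdGaussian_eq_map_pi_orthonormalBasis hA.eigenvectorBasis] at h1
  have h2 := congrArg (fun μ : Measure (EuclideanSpace ℝ (Fin d)) =>
    ∫ z, (z.ofLp ⬝ᵥ H.mulVec z.ofLp - H.trace) ^ 4 ∂μ) h1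
  have hm' : Continuous (fun z : EuclideanSpace ℝ (Fin d) =>
    (z.ofLp ⬝ᵥ H.mulVec z.ofLp - H.trace) ^ 4) := hm.comp (PiLp.continuous_ofLp 2 _)
  simp only at h2
  rw [integral_map (Continuous.aemeasurable (by fun_prop)) hm'.aestronglyMeasurable,
    integral_map (Continuous.aemeasurable (by fun_prop)) hm'.aestronglyMeasurable] at h2
  unfold _root_.stdGaussian
  refine h2.trans ?_
  simp_rw [quad_eig hA]
  rw [trace_pow_eig hA, trace_pow_eig hA, ← (sum_moments hA.eigenvalues Finset.univ).2.2.2]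
  have ht : H.trace = ∑ i, hA.eigenvalues i := by simpa using hA.trace_eq_sum_eigenvalues
  rw [ht]
  simp_rw [mul_sub, mul_one, Finset.sum_sub_distrib]
end

section
/- Let a ∈ ℝ, M ∈ ℝ^{d×d} symmetric, and ξ₁, ..., ξ_{M₁+M₂} i.i.d. standard Gaussians in ℝ^d. Define G₁ = a + (1/(2M₁)) Σ_{i=1}^{M₁} (ξᵢᵀMξᵢ − Tr M) and G₂ = a + (1/(2M₂)) Σ_{i=M₁+1}^{M₁+M₂} (ξᵢᵀMξᵢ − Tr M). Then E[G₁·G₂] = a², and E[G₁²·G₂²] − a⁴ = (1/(2M₁) + 1/(2M₂)) a² Tr(M²) + (1/(4M₁M₂)) (Tr(M²))². -/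
open MeasureTheory ProbabilityTheory Matrix

/-- Law of m i.i.d. standard Gaussian vectors in ℝ^d. -/
noncomputable def iidStdGaussians (m d : ℕ) : Measure (Fin m → Fin d → ℝ) :=
  Measure.pi fun _ => Measure.pi fun _ => gaussianReal 0 1

lemma gauss_deriv_aux (p p' : ℝ → ℝ) (hp : ∀ t, HasDerivAt p (p' t) t) :
    deriv (fun t => p t * Real.exp (t ^ 2 / 2)) =
      fun t => (p' t + p t * t) * Real.exp (t ^ 2 / 2) := by
  funext t
  have h1 : HasDerivAt (fun t : ℝ => t ^ 2 / 2) t t := by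
    have := (hasDerivAt_pow 2 t).div_const 2
    convert! this using 1
    norm_num
  refine (((hp t).mul h1.exp).deriv).trans ?_
  ring

lemma gauss_m4 : ∫ x, x ^ 4 ∂(gaussianReal 0 1) = 3 := by
  have h := iteratedDeriv_mgf_zero (X := id) (μ := gaussianReal 0 1)
    (by simp) 4
  have h0 : mgf id (gaussianReal 0 1) = fun t => 1 * Real.exp (t ^ 2 / 2) := by
    rw [mgf_id_gaussianReal]; funext t; simp
  rw [h0, iteratedDeriv_succ', iteratedDeriv_succ', iteratedDeriv_succ', iteratedDeriv_succ',
    iteratedDeriv_zero,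
    gauss_deriv_aux (fun _ => 1) (fun _ => 0) (fun t => hasDerivAt_const t 1),
    gauss_deriv_aux (fun t => 0 + 1 * t) (fun _ => 1)
      (fun t => by
        convert! hasDerivAt_id t using 1
        funext s; simp),
    gauss_deriv_aux (fun t => 1 + (0 + 1 * t) * t) (fun t => 2 * t)
      (fun t => by
        have := ((hasDerivAt_pow 2 t).const_add 1)
        convert! this using 1
        · funext s; simp; ring
        · norm_num),
    gauss_deriv_aux (fun t => 2 * t + (1 + (0 + 1 * t) * t) * t) (fun t => 3 + 3 * t ^ 2)
      (fun t => by
        have := ((hasDerivAt_id t).const_mul 3).add (hasDerivAt_pow 3 t)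
        convert! this using 1
        · funext s; simp; ring
        · norm_num)] at h
  simpa using h.symm

lemma gauss_m1 : ∫ x, x ∂(gaussianReal 0 1) = 0 := integral_id_gaussianReal

lemma gauss_m2 : ∫ x, x ^ 2 ∂(gaussianReal 0 1) = 1 := by
  have h := variance_fun_id_gaussianReal (μ := 0) (v := 1)
  rw [variance_eq_integral (by fun_prop)] at h
  simpa [integral_id_gaussianReal] using h

noncomputable abbrev gPi (d : ℕ) : Measure (Fin d → ℝ) := Measure.pi fun _ => gaussianReal 0 1

lemma memLp_coord {d : ℕ} (i : Fin d) (p : ENNReal) (hp : p ≠ ⊤) :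
    MemLp (fun x : Fin d → ℝ => x i) p (gPi d) :=
  (memLp_id_gaussianReal' (μ := 0) (v := 1) p hp).comp_measurePreserving
    (measurePreserving_eval (fun _ : Fin d => gaussianReal 0 1) i)

instance holder442 : ENNReal.HolderTriple 4 4 2 := ⟨by
  rw [← ENNReal.toReal_eq_toReal_iff' (by simp) (by simp)]
  rw [ENNReal.toReal_add (by simp) (by simp)]
  norm_num⟩

lemma memLp_pair {d : ℕ} (i j : Fin d) :
    MemLp (fun x : Fin d → ℝ => x i * x j) 2 (gPi d) :=
  (memLp_coord j 4 (by simp)).mul (memLp_coord i 4 (by simp))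

lemma int_coord {d : ℕ} (i : Fin d) (f : ℝ → ℝ) (hf : Continuous f) :
    ∫ x, f (x i) ∂(gPi d) = ∫ y, f y ∂(gaussianReal 0 1) := by
  have h := measurePreserving_eval (fun _ : Fin d => gaussianReal 0 1) i
  rw [← h.map_eq, integral_map h.measurable.aemeasurable hf.aestronglyMeasurable]

lemma iIndep_coord (d : ℕ) : iIndepFun (fun (i : Fin d) (x : Fin d → ℝ) => x i) (gPi d) :=
  iIndepFun_pi (X := fun _ => id) (fun _ => aemeasurable_id)

lemma int_pair_ne {d : ℕ} (i j : Fin d) (h : i ≠ j) :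
    ∫ x, x i ^ 2 * x j ^ 2 ∂(gPi d) = 1 := by
  have h1 : IndepFun (fun x : Fin d → ℝ => x i ^ 2) (fun x : Fin d → ℝ => x j ^ 2) (gPi d) :=
    ((iIndep_coord d).indepFun h).comp (φ := fun y : ℝ => y ^ 2) (ψ := fun y : ℝ => y ^ 2)
      (by fun_prop) (by fun_prop)
  rw [h1.integral_fun_mul_eq_mul_integral
      (Measurable.aestronglyMeasurable (by fun_prop))
      (Measurable.aestronglyMeasurable (by fun_prop)),
    int_coord i (fun y => y ^ 2) (by fun_prop), int_coord j (fun y => y ^ 2) (by fun_prop),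
    gauss_m2]
  norm_num

lemma int_lone {d : ℕ} (i j k l : Fin d) (hj : i ≠ j) (hk : i ≠ k) (hl : i ≠ l) :
    ∫ x, x i * (x j * x k * x l) ∂(gPi d) = 0 := by
  have h0 := (iIndep_coord d).indepFun_finset {i} {j, k, l} (by simp [hj, hk, hl])
    (fun i => by fun_prop)
  have hi : i ∈ ({i} : Finset (Fin d)) := by simp
  have hj' : j ∈ ({j, k, l} : Finset (Fin d)) := by simp
  have hk' : k ∈ ({j, k, l} : Finset (Fin d)) := by simp
  have hl' : l ∈ ({j, k, l} : Finset (Fin d)) := by simp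
  have h1 : IndepFun (fun x : Fin d → ℝ => x i) (fun x : Fin d → ℝ => x j * x k * x l) (gPi d) :=
    h0.comp (φ := fun v : ({i} : Finset (Fin d)) → ℝ => v ⟨i, hi⟩)
      (ψ := fun v : ({j, k, l} : Finset (Fin d)) → ℝ => v ⟨j, hj'⟩ * v ⟨k, hk'⟩ * v ⟨l, hl'⟩)
      (by fun_prop) (by fun_prop)
  rw [h1.integral_fun_mul_eq_mul_integral
      (Measurable.aestronglyMeasurable (by fun_prop))
      (Measurable.aestronglyMeasurable (by fun_prop)),
    int_coord i (fun y => y) (by fun_prop), gauss_m1, zero_mul]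

lemma int_two {d : ℕ} (i j : Fin d) :
    ∫ x, x i * x j ∂(gPi d) = if i = j then 1 else 0 := by
  split_ifs with h
  · subst h
    rw [← gauss_m2, ← int_coord i (fun y => y ^ 2) (by fun_prop)]
    simp only [sq]
  · rw [((iIndep_coord d).indepFun h).integral_fun_mul_eq_mul_integral
      (Measurable.aestronglyMeasurable (by fun_prop))
      (Measurable.aestronglyMeasurable (by fun_prop)),
      int_coord i (fun y => y) (by fun_prop), gauss_m1, zero_mul]

lemma int_four {d : ℕ} (i j k l : Fin d) :
    ∫ x, (x i * x j) * (x k * x l) ∂(gPi d) =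
      (if i = j then 1 else 0) * (if k = l then 1 else 0)
      + (if i = k then 1 else 0) * (if j = l then 1 else 0)
      + (if i = l then 1 else 0) * (if j = k then 1 else 0) := by
  by_cases hij : i = j
  · subst hij
    by_cases hkl : k = l
    · subst hkl
      by_cases hik : i = k
      · subst hik
        rw [show (fun x : Fin d → ℝ => (x i * x i) * (x i * x i)) = fun x => (x i) ^ 4 by
          funext x; ring, int_coord i (fun y => y ^ 4) (by fun_prop), gauss_m4]
        norm_num
      · rw [show (fun x : Fin d → ℝ => (x i * x i) * (x k * x k)) = fun x => x i ^ 2 * x k ^ 2 by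
          funext x; ring, int_pair_ne i k hik]
        simp [hik]
    · by_cases hik : i = k
      · subst hik
        rw [show (fun x : Fin d → ℝ => (x i * x i) * (x i * x l))
          = fun x => x l * (x i * x i * x i) by funext x; ring,
          int_lone l i i i (Ne.symm hkl) (Ne.symm hkl) (Ne.symm hkl)]
        simp [hkl]
      · rw [show (fun x : Fin d → ℝ => (x i * x i) * (x k * x l))
          = fun x => x k * (x i * x i * x l) by funext x; ring,
          int_lone k i i l (Ne.symm hik) (Ne.symm hik) hkl]
        simp [hkl, hik]
  · by_cases hik : i = k
    · subst hik
      by_cases hjl : j = l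
      · subst hjl
        rw [show (fun x : Fin d → ℝ => (x i * x j) * (x i * x j)) = fun x => x i ^ 2 * x j ^ 2 by
          funext x; ring, int_pair_ne i j hij]
        simp [hij]
      · rw [show (fun x : Fin d → ℝ => (x i * x j) * (x i * x l))
          = fun x => x j * (x i * x i * x l) by funext x; ring,
          int_lone j i i l (Ne.symm hij) (Ne.symm hij) hjl]
        simp [hij, hjl, Ne.symm hij]
    · by_cases hil : i = l
      · subst hil
        by_cases hjk : j = k
        · subst hjk
          rw [show (fun x : Fin d → ℝ => (x i * x j) * (x j * x i))
            = fun x => x i ^ 2 * x j ^ 2 by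
            funext x; ring, int_pair_ne i j hij]
          simp [hij]
        · rw [show (fun x : Fin d → ℝ => (x i * x j) * (x k * x i))
            = fun x => x j * (x i * x k * x i) by funext x; ring,
            int_lone j i k i (Ne.symm hij) hjk (Ne.symm hij)]
          simp [hij, hjk, hik]
      · rw [show (fun x : Fin d → ℝ => (x i * x j) * (x k * x l))
          = fun x => x i * (x j * x k * x l) by funext x; ring,
          int_lone i j k l hij hik hil]
        simp [hij, hik, hil]

lemma quad_expand {d : ℕ} (M : Matrix (Fin d) (Fin d) ℝ) (x : Fin d → ℝ) :
    x ⬝ᵥ M.mulVec x = ∑ p : Fin d × Fin d, M p.1 p.2 * (x p.1 * x p.2) := by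
  rw [Fintype.sum_prod_type]
  simp only [dotProduct, mulVec, Finset.mul_sum]
  refine Finset.sum_congr rfl fun i _ => Finset.sum_congr rfl fun j _ => by ring

lemma memLp_quad {d : ℕ} (M : Matrix (Fin d) (Fin d) ℝ) :
    MemLp (fun x : Fin d → ℝ => x ⬝ᵥ M.mulVec x) 2 (gPi d) := by
  simp only [quad_expand]
  exact memLp_finsetSum _ fun p _ => (memLp_pair p.1 p.2).const_mul _

lemma int_quad {d : ℕ} (M : Matrix (Fin d) (Fin d) ℝ) :
    ∫ x, x ⬝ᵥ M.mulVec x ∂(gPi d) = M.trace := by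
  simp only [quad_expand]
  rw [integral_finsetSum _ fun p _ =>
    ((memLp_pair p.1 p.2).integrable (by norm_num)).const_mul _]
  simp only [integral_const_mul, int_two]
  rw [Fintype.sum_prod_type]
  simp [Matrix.trace]

lemma int_quad_sq {d : ℕ} (M : Matrix (Fin d) (Fin d) ℝ) (hM : M.IsSymm) :
    ∫ x, (x ⬝ᵥ M.mulVec x) ^ 2 ∂(gPi d) = M.trace ^ 2 + 2 * (M ^ 2).trace := by
  simp only [quad_expand, sq, Finset.sum_mul_sum]
  have hint : ∀ p q : Fin d × Fin d, Integrable (fun x : Fin d → ℝ =>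
      M p.1 p.2 * (x p.1 * x p.2) * (M q.1 q.2 * (x q.1 * x q.2))) (gPi d) := fun p q =>
    ((memLp_pair p.1 p.2).const_mul _).integrable_mul ((memLp_pair q.1 q.2).const_mul _)
  rw [integral_finsetSum _ fun p _ => integrable_finsetSum _ fun q _ => hint p q]
  simp_rw [integral_finsetSum _ fun q _ => hint _ q]
  have h : ∀ p q : Fin d × Fin d,
      ∫ x, M p.1 p.2 * (x p.1 * x p.2) * (M q.1 q.2 * (x q.1 * x q.2)) ∂(gPi d)
      = M p.1 p.2 * M q.1 q.2 * (
      (if p.1 = p.2 then 1 else 0) * (if q.1 = q.2 then 1 else 0)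
      + (if p.1 = q.1 then 1 else 0) * (if p.2 = q.2 then 1 else 0)
      + (if p.1 = q.2 then 1 else 0) * (if p.2 = q.1 then 1 else 0)) := by
    intro p q
    rw [← int_four, ← integral_const_mul]
    congr 1; funext x; ring
  simp only [h, mul_add, Finset.sum_add_distrib, Fintype.sum_prod_type]
  have hs : ∀ i j, M j i = M i j := fun i j => hM.apply i j
  have e1 : ∑ i, ∑ j, ∑ k, ∑ l, M i j * M k l *
      ((if i = j then (1 : ℝ) else 0) * (if k = l then 1 else 0)) = M.trace * M.trace := by
    simp only [Matrix.trace, Finset.sum_mul_sum, Matrix.diag]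
    have : ∀ i j k l, M i j * M k l * ((if i = j then (1 : ℝ) else 0) * (if k = l then 1 else 0))
        = if j = i then (if l = k then M i j * M k l else 0) else 0 := by
      intro i j k l
      by_cases h1 : i = j <;> by_cases h2 : k = l <;> simp [h1, h2, eq_comm]
    simp only [this]
    refine Finset.sum_congr rfl fun i _ => ?_
    rw [Finset.sum_eq_single i]
    · simp
    · intro j _ hj; simp [hj]
    · simp
  have e2 : ∑ i, ∑ j, ∑ k, ∑ l, M i j * M k l *
      ((if i = k then (1 : ℝ) else 0) * (if j = l then 1 else 0)) = (M * M).trace := by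
    simp only [Matrix.trace, Matrix.mul_apply, Matrix.diag]
    refine Finset.sum_congr rfl fun i _ => Finset.sum_congr rfl fun j _ => ?_
    rw [hs i j]
    simp
  have e3 : ∑ i, ∑ j, ∑ k, ∑ l, M i j * M k l *
      ((if i = l then (1 : ℝ) else 0) * (if j = k then 1 else 0)) = (M * M).trace := by
    simp only [Matrix.trace, Matrix.mul_apply, Matrix.diag]
    refine Finset.sum_congr rfl fun i _ => Finset.sum_congr rfl fun j _ => ?_
    simp
  rw [e1, e2, e3]
  ring

/-- First two moments of an affine function of an empirical sum. -/
lemma group_moments {X : Type*} [MeasurableSpace X] (μ : Measure X) [IsProbabilityMeasure μ]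
    (q : X → ℝ) (hq : MemLp q 2 μ) (hm : Measurable q) (h0 : ∫ x, q x ∂μ = 0)
    {n m : ℕ} (e : Fin m → Fin n) (he : Function.Injective e) (a c : ℝ) :
    (∫ ξ : Fin n → X, (a + c * ∑ i, q (ξ (e i))) ∂(Measure.pi fun _ => μ) = a) ∧
    (∫ ξ : Fin n → X, (a + c * ∑ i, q (ξ (e i))) ^ 2 ∂(Measure.pi fun _ => μ)
      = a ^ 2 + c ^ 2 * (m * ∫ x, q x ^ 2 ∂μ)) := by
  set P : Measure (Fin n → X) := Measure.pi fun _ => μ with hP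
  have hmp : ∀ i : Fin n, MeasurePreserving (fun ξ : Fin n → X => ξ i) P μ :=
    fun i => measurePreserving_eval (fun _ => μ) i
  have hY : ∀ i : Fin m, MemLp (fun ξ : Fin n → X => q (ξ (e i))) 2 P :=
    fun i => hq.comp_measurePreserving (hmp (e i))
  have hE : ∀ i : Fin m, ∫ ξ, q (ξ (e i)) ∂P = 0 := by
    intro i
    rw [← h0, ← (hmp (e i)).map_eq, integral_map (hmp (e i)).measurable.aemeasurable
      hm.aestronglyMeasurable]
  have hV : ∀ i : Fin m, variance (fun ξ : Fin n → X => q (ξ (e i))) P = ∫ x, q x ^ 2 ∂μ := by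
    intro i
    rw [variance_of_integral_eq_zero (hY i).aemeasurable (hE i)]
    rw [← (hmp (e i)).map_eq, integral_map (hmp (e i)).measurable.aemeasurable
      (hm.pow_const 2).aestronglyMeasurable]
  have hS : MemLp (fun ξ : Fin n → X => ∑ i, q (ξ (e i))) 2 P :=
    memLp_finsetSum _ fun i _ => hY i
  have hSi := hS.integrable (by norm_num)
  have hES : ∫ ξ, ∑ i, q (ξ (e i)) ∂P = 0 := by
    rw [integral_finsetSum _ fun i _ => (hY i).integrable (by norm_num)]
    simp [hE]
  have hind : iIndepFun (fun (i : Fin n) (ξ : Fin n → X) => q (ξ i)) P :=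
    iIndepFun_pi (X := fun _ => q) (fun _ => hm.aemeasurable)
  have hVS : ∫ ξ, (∑ i, q (ξ (e i))) ^ 2 ∂P = m * ∫ x, q x ^ 2 ∂μ := by
    rw [← variance_of_integral_eq_zero hS.aemeasurable hES]
    have := IndepFun.variance_sum (μ := P) (X := fun (i : Fin m) (ξ : Fin n → X) => q (ξ (e i)))
      (s := Finset.univ) (fun i _ => hY i)
      (fun i _ j _ hij => hind.indepFun (he.ne hij))
    rw [show (fun ξ : Fin n → X => ∑ i, q (ξ (e i)))
      = ∑ i, (fun (i : Fin m) (ξ : Fin n → X) => q (ξ (e i))) i by funext ξ; simp, this]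
    simp [hV]
  constructor
  · rw [integral_add (integrable_const _) (hSi.const_mul c), integral_const_mul, hES]
    simp
  · have : (fun ξ : Fin n → X => (a + c * ∑ i, q (ξ (e i))) ^ 2) = fun ξ =>
        (a ^ 2 + (2 * a * c) * ∑ i, q (ξ (e i))) + c ^ 2 * (∑ i, q (ξ (e i))) ^ 2 := by
      funext ξ; ring
    have hA : Integrable (fun ξ : Fin n → X => a ^ 2 + (2 * a * c) * ∑ i, q (ξ (e i))) P :=
      (integrable_const _).add (hSi.const_mul _)
    rw [this, integral_add hA
      (hS.integrable_sq.const_mul _), integral_add (integrable_const _) (hSi.const_mul _),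
      integral_const_mul, integral_const_mul, hES, hVS]
    simp

/-- Unbiasedness and exact variance of the Un-EM-BSDE one-step loss at leading
order: with two independent groups of shots, E[G₁G₂] = a², and
E[G₁²G₂²] − a⁴ = (1/(2M₁) + 1/(2M₂)) a² Tr(M²) + (1/(4M₁M₂)) (Tr(M²))². -/
theorem un_em_bsde_unbiased_and_variance
    (d M₁ M₂ : ℕ) (hM₁ : 1 ≤ M₁) (hM₂ : 1 ≤ M₂) (a : ℝ)
    (M : Matrix (Fin d) (Fin d) ℝ) (hM : M.IsSymm)
    (G₁ G₂ : (Fin (M₁ + M₂) → Fin d → ℝ) → ℝ)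
    (hG₁ : G₁ = fun ξ => a + (1 / (2 * (M₁ : ℝ))) *
        ∑ i : Fin M₁, (ξ (Fin.castAdd M₂ i) ⬝ᵥ M.mulVec (ξ (Fin.castAdd M₂ i)) - M.trace))
    (hG₂ : G₂ = fun ξ => a + (1 / (2 * (M₂ : ℝ))) *
        ∑ i : Fin M₂, (ξ (Fin.natAdd M₁ i) ⬝ᵥ M.mulVec (ξ (Fin.natAdd M₁ i)) - M.trace)) :
    (∫ ξ, G₁ ξ * G₂ ξ ∂(iidStdGaussians (M₁ + M₂) d) = a ^ 2) ∧
    (∫ ξ, G₁ ξ ^ 2 * G₂ ξ ^ 2 ∂(iidStdGaussians (M₁ + M₂) d) - a ^ 4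
      = (1 / (2 * (M₁ : ℝ)) + 1 / (2 * (M₂ : ℝ))) * a ^ 2 * (M ^ 2).trace
        + (1 / (4 * (M₁ : ℝ) * (M₂ : ℝ))) * (M ^ 2).trace ^ 2) := by
  set q : (Fin d → ℝ) → ℝ := fun x => x ⬝ᵥ M.mulVec x - M.trace with hq
  have hqL : MemLp q 2 (gPi d) := (memLp_quad M).sub (memLp_const _)
  have hqm : Measurable q := by
    simp only [hq, quad_expand]; fun_prop
  have hi := (memLp_quad M).integrable (by norm_num)
  have hq0 : ∫ x, q x ∂(gPi d) = 0 := by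
    simp only [hq]
    rw [integral_sub hi (integrable_const _), int_quad]; simp
  have hq2 : ∫ x, q x ^ 2 ∂(gPi d) = 2 * (M ^ 2).trace := by
    have : (fun x => q x ^ 2) = fun x => ((x ⬝ᵥ M.mulVec x) ^ 2
        - (2 * M.trace) * (x ⬝ᵥ M.mulVec x)) + M.trace ^ 2 := by
      funext x; simp only [hq]; ring
    have hA : Integrable (fun x : Fin d → ℝ => (x ⬝ᵥ M.mulVec x) ^ 2
        - (2 * M.trace) * (x ⬝ᵥ M.mulVec x)) (gPi d) :=
      (memLp_quad M).integrable_sq.sub (hi.const_mul _)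
    rw [this, integral_add hA
      (integrable_const _), integral_sub (memLp_quad M).integrable_sq (hi.const_mul _),
      integral_const_mul, int_quad, int_quad_sq M hM]
    simp; ring
  obtain ⟨m1, v1⟩ := group_moments (gPi d) q hqL hqm hq0 (Fin.castAdd M₂ : Fin M₁ → _)
    (Fin.castAdd_injective M₁ M₂) a (1 / (2 * (M₁ : ℝ)))
  obtain ⟨m2, v2⟩ := group_moments (gPi d) q hqL hqm hq0 (Fin.natAdd M₁ : Fin M₂ → _)
    (Fin.natAdd_injective M₂ M₁) a (1 / (2 * (M₂ : ℝ)))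
  have hind : iIndepFun (fun (i : Fin (M₁ + M₂)) (ξ : Fin (M₁ + M₂) → Fin d → ℝ) => q (ξ i))
      (iidStdGaussians (M₁ + M₂) d) :=
    iIndepFun_pi (X := fun _ => q) (fun _ => hqm.aemeasurable)
  have hI : IndepFun G₁ G₂ (iidStdGaussians (M₁ + M₂) d) := by
    have h0 := hind.indepFun_finset (Finset.univ.image (Fin.castAdd M₂ : Fin M₁ → _))
      (Finset.univ.image (Fin.natAdd M₁ : Fin M₂ → _))
      (by
        rw [Finset.disjoint_left]
        simp only [Finset.mem_image, Finset.mem_univ, true_and, not_exists]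
        rintro _ ⟨i, rfl⟩ j hj
        have := congrArg Fin.val hj
        simp at this
        omega)
      (fun i => hqm.comp (measurable_pi_apply i))
    have hc : ∀ i : Fin M₁, Fin.castAdd M₂ i ∈ Finset.univ.image (Fin.castAdd M₂ : Fin M₁ → _) :=
      fun i => Finset.mem_image_of_mem _ (Finset.mem_univ i)
    have hn : ∀ i : Fin M₂, Fin.natAdd M₁ i ∈ Finset.univ.image (Fin.natAdd M₁ : Fin M₂ → _) :=
      fun i => Finset.mem_image_of_mem _ (Finset.mem_univ i)
    rw [hG₁, hG₂]
    exact h0.comp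
      (φ := fun v => a + (1 / (2 * (M₁ : ℝ))) * ∑ i : Fin M₁, v ⟨Fin.castAdd M₂ i, hc i⟩)
      (ψ := fun v => a + (1 / (2 * (M₂ : ℝ))) * ∑ i : Fin M₂, v ⟨Fin.natAdd M₁ i, hn i⟩)
      (by fun_prop) (by fun_prop)
  have hm1 : Measurable G₁ := by
    rw [hG₁]
    exact ((Finset.measurable_sum _ fun i _ =>
      hqm.comp (measurable_pi_apply (Fin.castAdd M₂ i))).const_mul _).const_add _
  have hm2 : Measurable G₂ := by
    rw [hG₂]
    exact ((Finset.measurable_sum _ fun i _ =>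
      hqm.comp (measurable_pi_apply (Fin.natAdd M₁ i))).const_mul _).const_add _
  have m1' : ∫ ξ, G₁ ξ ∂(iidStdGaussians (M₁ + M₂) d) = a := by rw [hG₁]; exact m1
  have m2' : ∫ ξ, G₂ ξ ∂(iidStdGaussians (M₁ + M₂) d) = a := by rw [hG₂]; exact m2
  rw [hq2] at v1 v2
  have v1' : ∫ ξ, G₁ ξ ^ 2 ∂(iidStdGaussians (M₁ + M₂) d)
      = a ^ 2 + (1 / (2 * (M₁ : ℝ))) ^ 2 * (M₁ * (2 * (M ^ 2).trace)) := by rw [hG₁]; exact v1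
  have v2' : ∫ ξ, G₂ ξ ^ 2 ∂(iidStdGaussians (M₁ + M₂) d)
      = a ^ 2 + (1 / (2 * (M₂ : ℝ))) ^ 2 * (M₂ * (2 * (M ^ 2).trace)) := by rw [hG₂]; exact v2
  have hI2 : IndepFun (fun ξ => G₁ ξ ^ 2) (fun ξ => G₂ ξ ^ 2) (iidStdGaussians (M₁ + M₂) d) :=
    hI.comp (φ := fun y : ℝ => y ^ 2) (ψ := fun y : ℝ => y ^ 2) (by fun_prop) (by fun_prop)
  constructor
  · rw [hI.integral_fun_mul_eq_mul_integral hm1.aestronglyMeasurable hm2.aestronglyMeasurable,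
      m1', m2']
    ring
  · rw [hI2.integral_fun_mul_eq_mul_integral (hm1.pow_const 2).aestronglyMeasurable
      (hm2.pow_const 2).aestronglyMeasurable, v1', v2']
    have h1 : (M₁ : ℝ) ≠ 0 := by positivity
    have h2 : (M₂ : ℝ) ≠ 0 := by positivity
    field_simp
    ring
end
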